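/- Existence of a tangent space at a point of a pseudoholomorphic curve: Let J be an almost complex structure on ℂⁿ with J(0) equal to multiplication by i, and let u : B → ℂⁿ be a nonconstant smooth J-holomorphic curve with u(0) = 0. Then there exist a unique complex 1-dimensional subspace T ⊆ ℂⁿ and a unique positive integer k such that for every z ∈ B \ {0} the limit of ε^{−k}·u(εz) as ε → 0 through positive real numbers exists and is a nonzero vector belonging to T. -/

import Mathlib

open Metric Complex Filter

/-- A logarithmic convexity principle: if `f ≥ 0` satisfies `f' ≤ 2 D + O(eˢ) f` and the quotient
`D / f` is nondecreasing up to an error `O(e²ˢ)`, then `f` decays at most exponentially at `-∞`. -/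
theorem exists_exp_lower_bound {f f' D D' : ℝ → ℝ} {a K s₀ : ℝ} (hK : 0 ≤ K)
    (hf : ∀ s < a, HasDerivAt f (f' s) s) (hD : ∀ s < a, HasDerivAt D (D' s) s)
    (hnn : ∀ s < a, 0 ≤ f s)
    (h₁ : ∀ s < a, f' s ≤ 2 * D s + 2 * K * Real.exp s * f s)
    (h₂ : ∀ s < a, 0 < f s →
      -(K ^ 2 / 2 * Real.exp (2 * s)) * f s ^ 2 ≤ D' s * f s - D s * f' s)
    (hs₀ : s₀ < a) (hpos : 0 < f s₀) :
    ∃ M c : ℝ, 0 < c ∧ ∀ s ≤ s₀, c * Real.exp (M * s) ≤ f s := by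
  set N₀ := D s₀ / f s₀ + K ^ 2 / 4 * Real.exp (2 * s₀) with hN₀
  set M := 2 * N₀ + 2 * K * Real.exp s₀ with hM
  have key : ∀ s ≤ s₀, (∀ x ∈ Set.Icc s s₀, 0 < f x) →
      f s₀ * Real.exp (-M * s₀) ≤ f s * Real.exp (-M * s) := by
    intro s hs hp
    have hlt : ∀ x ∈ Set.Icc s s₀, x < a := fun x hx => hx.2.trans_lt hs₀
    have hexp : ∀ x : ℝ, HasDerivAt (fun y : ℝ => Real.exp (2 * y)) (Real.exp (2 * x) * 2) x := by
      intro x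
      simpa using ((hasDerivAt_id x).const_mul 2).exp
    have hder : ∀ x ∈ Set.Icc s s₀,
        HasDerivAt (fun y => D y / f y + K ^ 2 / 4 * Real.exp (2 * y))
          ((D' x * f x - D x * f' x) / f x ^ 2 + K ^ 2 / 4 * (Real.exp (2 * x) * 2)) x :=
      fun x hx => ((hD x (hlt x hx)).div (hf x (hlt x hx)) (hp x hx).ne').add
        ((hexp x).const_mul _)
    have hmono : MonotoneOn (fun y => D y / f y + K ^ 2 / 4 * Real.exp (2 * y))
        (Set.Icc s s₀) := by
      refine monotoneOn_of_hasDerivWithinAt_nonneg (convex_Icc _ _)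
        (fun x hx => (hder x hx).continuousAt.continuousWithinAt)
        (fun x hx => (hder x (interior_subset hx)).hasDerivWithinAt) ?_
      intro x hx
      have hx' := interior_subset hx
      have hfx := hp x hx'
      have h := h₂ x (hlt x hx') hfx
      have : -(K ^ 2 / 2 * Real.exp (2 * x)) ≤ (D' x * f x - D x * f' x) / f x ^ 2 := by
        rw [le_div_iff₀ (by positivity)]
        exact h
      linarith
    have hder' : ∀ x ∈ Set.Icc s s₀, HasDerivAt (fun y => f y * Real.exp (-M * y))
        (f' x * Real.exp (-M * x) + f x * (Real.exp (-M * x) * -M)) x := by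
      intro x hx
      have : HasDerivAt (fun y : ℝ => Real.exp (-M * y)) (Real.exp (-M * x) * -M) x := by
        simpa using ((hasDerivAt_id x).const_mul (-M)).exp
      exact (hf x (hlt x hx)).mul this
    have hanti : AntitoneOn (fun y => f y * Real.exp (-M * y)) (Set.Icc s s₀) := by
      refine antitoneOn_of_hasDerivWithinAt_nonpos (convex_Icc _ _)
        (fun x hx => (hder' x hx).continuousAt.continuousWithinAt)
        (fun x hx => (hder' x (interior_subset hx)).hasDerivWithinAt) ?_
      intro x hx
      have hx' := interior_subset hx
      have hfx := hp x hx'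
      have hN := hmono hx' (Set.right_mem_Icc.2 hs) hx'.2
      simp only at hN
      rw [← hN₀] at hN
      have hN' : D x / f x ≤ N₀ := by
        have : 0 ≤ K ^ 2 / 4 * Real.exp (2 * x) := by positivity
        linarith
      rw [div_le_iff₀ hfx] at hN'
      have hKe : K * Real.exp x * f x ≤ K * Real.exp s₀ * f x := by
        gcongr
        exact hx'.2
      have := h₁ x (hlt x hx')
      have h3 : f' x - M * f x ≤ 0 := by
        rw [hM]; nlinarith
      have : f' x * Real.exp (-M * x) + f x * (Real.exp (-M * x) * -M)
        = (f' x - M * f x) * Real.exp (-M * x) := by ring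
      rw [this]
      exact mul_nonpos_of_nonpos_of_nonneg h3 (Real.exp_pos _).le
    exact hanti (Set.left_mem_Icc.2 hs) (Set.right_mem_Icc.2 hs) hs
  have hcont : ∀ x ≤ s₀, ContinuousAt f x := fun x hx => (hf x (hx.trans_lt hs₀)).continuousAt
  have hall : ∀ s ≤ s₀, 0 < f s := by
    intro s hs
    by_contra hneg
    have hzero : f s = 0 := le_antisymm (not_lt.1 hneg) (hnn s (hs.trans_lt hs₀))
    set Z := Set.Icc s s₀ ∩ f ⁻¹' {0}
    have hZc : IsClosed Z := ContinuousOn.preimage_isClosed_of_isClosed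
      (fun x hx => (hcont x hx.2).continuousWithinAt) isClosed_Icc isClosed_singleton
    have hZne : Z.Nonempty := ⟨s, ⟨le_rfl, hs⟩, hzero⟩
    have hZb : BddAbove Z := ⟨s₀, fun x hx => hx.1.2⟩
    have hmem : sSup Z ∈ Z := hZc.csSup_mem hZne hZb
    set m := sSup Z
    have hm₀ : f m = 0 := hmem.2
    have hms : m < s₀ := lt_of_le_of_ne hmem.1.2 (by rintro h; rw [h] at hm₀; linarith)
    have hposm : ∀ x, m < x → x ≤ s₀ → 0 < f x := by
      intro x hx hx'
      refine lt_of_le_of_ne (hnn x (hx'.trans_lt hs₀)) (fun h => ?_)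
      exact absurd (le_csSup hZb (⟨⟨hmem.1.1.trans hx.le, hx'⟩, h.symm⟩ : x ∈ Z)) (not_le.2 hx)
    have hlim : Tendsto (fun x => f x * Real.exp (-M * x)) (nhdsWithin m (Set.Ioi m))
        (nhds (f m * Real.exp (-M * m))) := by
      have : ContinuousAt (fun x => f x * Real.exp (-M * x)) m :=
        (hcont m hms.le).mul (by fun_prop)
      exact this.tendsto.mono_left nhdsWithin_le_nhds
    have hge : f s₀ * Real.exp (-M * s₀) ≤ f m * Real.exp (-M * m) := by
      refine ge_of_tendsto hlim ?_
      filter_upwards [Ioo_mem_nhdsGT hms] with x hx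
      exact key x hx.2.le (fun y hy => hposm y (hx.1.trans_le hy.1) hy.2)
    rw [hm₀, zero_mul] at hge
    have : 0 < f s₀ * Real.exp (-M * s₀) := by positivity
    linarith
  refine ⟨M, f s₀ * Real.exp (-M * s₀), by positivity, fun s hs => ?_⟩
  have h := key s hs (fun x hx => hall x hx.2)
  have h2 : f s₀ * Real.exp (-M * s₀) * Real.exp (M * s) ≤
      f s * Real.exp (-M * s) * Real.exp (M * s) := by gcongr
  rwa [mul_assoc (f s), ← Real.exp_add, show -M * s + M * s = 0 by ring, Real.exp_zero,
    mul_one] at h2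

theorem continuous_slice_of_continuousOn {X : Type*} [TopologicalSpace X] {G : ℝ × ℝ → X}
    {a : ℝ} (hG : ContinuousOn G (Set.Iio a ×ˢ Set.univ)) {s : ℝ} (hs : s < a) :
    Continuous fun t : ℝ => G (s, t) :=
  hG.comp_continuous (by fun_prop) fun _ => ⟨hs, trivial⟩

theorem hasDerivAt_slice_fst {E : Type*} [NormedAddCommGroup E] [NormedSpace ℝ E]
    {G : ℝ × ℝ → E} {p : ℝ × ℝ} (hG : DifferentiableAt ℝ G p) :
    HasDerivAt (fun x => G (x, p.2)) (fderiv ℝ G p (1, 0)) p.1 := by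
  have h : HasDerivAt (fun x : ℝ => (x, p.2)) ((1 : ℝ), (0 : ℝ)) p.1 :=
    (hasDerivAt_id _).prodMk (hasDerivAt_const _ _)
  exact hG.hasFDerivAt.comp_hasDerivAt (f := fun x : ℝ => (x, p.2)) p.1 h

theorem hasDerivAt_slice_snd {E : Type*} [NormedAddCommGroup E] [NormedSpace ℝ E]
    {G : ℝ × ℝ → E} {p : ℝ × ℝ} (hG : DifferentiableAt ℝ G p) :
    HasDerivAt (fun x => G (p.1, x)) (fderiv ℝ G p (0, 1)) p.2 := by
  have h : HasDerivAt (fun x : ℝ => (p.1, x)) ((0 : ℝ), (1 : ℝ)) p.2 :=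
    (hasDerivAt_const _ _).prodMk (hasDerivAt_id _)
  exact hG.hasFDerivAt.comp_hasDerivAt (f := fun x : ℝ => (p.1, x)) p.2 h

theorem hasDerivAt_intervalIntegral_slice {G : ℝ × ℝ → ℝ} {a : ℝ}
    (hG : ContDiffOn ℝ 1 G (Set.Iio a ×ˢ Set.univ)) (c d : ℝ) {s : ℝ} (hs : s < a) :
    HasDerivAt (fun x => ∫ t in c..d, G (x, t)) (∫ t in c..d, fderiv ℝ G (s, t) (1, 0)) s := by
  have hopen : IsOpen (Set.Iio a ×ˢ (Set.univ : Set ℝ)) := isOpen_Iio.prod isOpen_univ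
  have hG' : ContinuousOn (fun p => fderiv ℝ G p (1, 0)) (Set.Iio a ×ˢ Set.univ) :=
    (hG.continuousOn_fderiv_of_isOpen hopen le_rfl).clm_apply continuousOn_const
  set b := (s + a) / 2 with hb
  have hsb : s < b := by rw [hb]; linarith
  have hba : b < a := by rw [hb]; linarith
  obtain ⟨C, hC⟩ := (isCompact_Icc.prod isCompact_uIcc :
    IsCompact (Set.Icc (s - 1) b ×ˢ Set.uIcc c d)).exists_bound_of_continuousOn
      (hG'.mono (Set.prod_mono (fun x hx => hx.2.trans_lt hba) (Set.subset_univ _)))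
  refine (intervalIntegral.hasDerivAt_integral_of_dominated_loc_of_deriv_le
    (F := fun x t => G (x, t)) (F' := fun x t => fderiv ℝ G (x, t) (1, 0))
    (bound := fun _ => C) (Icc_mem_nhds (sub_one_lt s) hsb) ?_ ?_ ?_ ?_ ?_ ?_).2
  · filter_upwards [Iio_mem_nhds hs] with x hx
    exact (continuous_slice_of_continuousOn hG.continuousOn hx).aestronglyMeasurable
  · exact (continuous_slice_of_continuousOn hG.continuousOn hs).intervalIntegrable _ _
  · exact (continuous_slice_of_continuousOn hG' hs).aestronglyMeasurable
  · exact .of_forall fun t ht x hx => hC (x, t) ⟨hx, Set.uIoc_subset_uIcc ht⟩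
  · exact intervalIntegrable_const
  · refine .of_forall fun t ht x hx => ?_
    have hmem : (x, t) ∈ Set.Iio a ×ˢ (Set.univ : Set ℝ) := ⟨hx.2.trans_lt hba, trivial⟩
    exact hasDerivAt_slice_fst (p := (x, t))
      ((hG.differentiableOn one_ne_zero).differentiableAt (hopen.mem_nhds hmem))

/-- A nonzero solution of `|∂ₛF + I ∂ₜF| ≤ K eˢ |F|` on a half-infinite cylinder, with `I` skew,
decays at most exponentially in mean square. -/
theorem exists_exp_lower_bound_integral_norm_sq {E : Type*} [NormedAddCommGroup E]
    [InnerProductSpace ℝ E] (I : E →L[ℝ] E)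
    (hskew : ∀ x y, inner ℝ (I x) y = -inner ℝ x (I y))
    {F : ℝ × ℝ → E} {a K : ℝ} (hK : 0 ≤ K)
    (hF : ContDiffOn ℝ 2 F (Set.Iio a ×ˢ Set.univ))
    (hper : ∀ p, F (p + (0, 2 * Real.pi)) = F p)
    (hE : ∀ p ∈ Set.Iio a ×ˢ (Set.univ : Set ℝ),
      ‖fderiv ℝ F p (1, 0) + I (fderiv ℝ F p (0, 1))‖ ≤ K * Real.exp p.1 * ‖F p‖)
    {s₀ τ : ℝ} (hs₀ : s₀ < a) (hne : F (s₀, τ) ≠ 0) :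
    ∃ M c : ℝ, 0 < c ∧ ∀ s ≤ s₀,
      c * Real.exp (M * s) ≤ ∫ t in τ..(τ + 2 * Real.pi), ‖F (s, t)‖ ^ 2 := by
  set Ω : Set (ℝ × ℝ) := Set.Iio a ×ˢ Set.univ
  have hopen : IsOpen Ω := isOpen_Iio.prod isOpen_univ
  set b := τ + 2 * Real.pi with hb
  have hτb : τ < b := by rw [hb]; linarith [Real.pi_pos]
  have hF₁ : ContDiffOn ℝ 1 F Ω := hF.of_le (by norm_num)
  have hdF : ContDiffOn ℝ 1 (fderiv ℝ F) Ω := hF.fderiv_of_isOpen hopen (by norm_num)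
  have hFs : ContDiffOn ℝ 1 (fun p => fderiv ℝ F p (1, 0)) Ω := hdF.clm_apply contDiffOn_const
  have hFt : ContDiffOn ℝ 1 (fun p => fderiv ℝ F p (0, 1)) Ω := hdF.clm_apply contDiffOn_const
  set A : ℝ × ℝ → E := fun p => -I (fderiv ℝ F p (0, 1)) with hAdef
  set B : ℝ × ℝ → E := fun p => fderiv ℝ F p (1, 0) with hBdef
  have hA : ContDiffOn ℝ 1 A Ω := (I.contDiff.comp_contDiffOn hFt).neg
  have hIB : ContDiffOn ℝ 1 (fun p => -I (B p)) Ω := (I.contDiff.comp_contDiffOn hFs).neg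
  have hdiff : ∀ {G : ℝ × ℝ → E}, ContDiffOn ℝ 1 G Ω → ∀ p ∈ Ω, DifferentiableAt ℝ G p :=
    fun hG p hp => (hG.differentiableOn one_ne_zero).differentiableAt (hopen.mem_nhds hp)
  have hii : ∀ {G H : ℝ × ℝ → E}, ContDiffOn ℝ 1 G Ω → ContDiffOn ℝ 1 H Ω → ∀ s < a,
      IntervalIntegrable (fun t => inner ℝ (G (s, t)) (H (s, t))) MeasureTheory.volume τ b :=
    fun hG hH s hs => (continuous_slice_of_continuousOn
      (hG.inner ℝ hH).continuousOn hs).intervalIntegrable _ _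
  have hff : ∀ s < a, HasDerivAt (fun s => ∫ t in τ..b, inner ℝ (F (s, t)) (F (s, t)))
      (∫ t in τ..b, 2 * inner ℝ (B (s, t)) (F (s, t))) s := by
    intro s hs
    convert hasDerivAt_intervalIntegral_slice (hF₁.inner ℝ hF₁) τ b hs using 3 with t
    have := hdiff hF₁ (s, t) ⟨hs, trivial⟩
    rw [fderiv_inner_apply ℝ this this, real_inner_comm (F (s, t)), hBdef]
    ring
  have hperB : ∀ p, B (p + (0, 2 * Real.pi)) = B p := by
    intro p
    have : (fun q => F (q + (0, 2 * Real.pi))) = F := funext hper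
    simp only [hBdef]
    rw [← fderiv_comp_add_right, this]
  have hDD : ∀ s < a, HasDerivAt (fun s => ∫ t in τ..b, inner ℝ (A (s, t)) (F (s, t)))
      (∫ t in τ..b, 2 * inner ℝ (A (s, t)) (B (s, t))) s := by
    intro s hs
    have h := hasDerivAt_intervalIntegral_slice (hA.inner ℝ hF₁) τ b hs
    have hH : ContDiffOn ℝ 1 (fun p => inner ℝ (-I (B p)) (F p)) Ω := hIB.inner ℝ hF₁
    have hHd : ∀ t, HasDerivAt (fun x => inner ℝ (-I (B (s, x))) (F (s, x)))
        (fderiv ℝ (fun p => inner ℝ (-I (B p)) (F p)) (s, t) (0, 1)) t := fun t =>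
      hasDerivAt_slice_snd (p := (s, t)) ((hH.differentiableOn one_ne_zero).differentiableAt
        (hopen.mem_nhds ⟨hs, trivial⟩))
    have hHc : Continuous fun t =>
        fderiv ℝ (fun p => inner ℝ (-I (B p)) (F p)) (s, t) (0, 1) :=
      continuous_slice_of_continuousOn
        (G := fun q => fderiv ℝ (fun p => inner ℝ (-I (B p)) (F p)) q (0, 1))
        ((hH.continuousOn_fderiv_of_isOpen hopen le_rfl).clm_apply continuousOn_const) hs
    have hzero : ∫ t in τ..b, fderiv ℝ (fun p => inner ℝ (-I (B p)) (F p)) (s, t) (0, 1) = 0 := by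
      rw [intervalIntegral.integral_eq_sub_of_hasDerivAt (fun t _ => hHd t)
        (hHc.intervalIntegrable _ _)]
      have h1 : (s, b) = (s, τ) + (0, 2 * Real.pi) := by simp [hb]
      rw [h1, hper, hperB, sub_self]
    convert h using 1
    refine (add_zero _).symm.trans ((congrArg _ hzero.symm).trans ?_)
    rw [← intervalIntegral.integral_add ((hii hA hFs s hs).const_mul 2)
        (hHc.intervalIntegrable _ _)]
    refine intervalIntegral.integral_congr fun t _ => ?_
    have hp : (s, t) ∈ Ω := ⟨hs, trivial⟩
    have hsymm : IsSymmSndFDerivAt ℝ F (s, t) :=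
      (hF.contDiffAt (hopen.mem_nhds hp)).isSymmSndFDerivAt (by simp)
    have hd2 := (hdF.differentiableOn one_ne_zero).differentiableAt (hopen.mem_nhds hp)
    have hAd : fderiv ℝ A (s, t) (1, 0) =
        -I (fderiv ℝ (fderiv ℝ F) (s, t) (1, 0) (0, 1)) := by
      have h1 : HasFDerivAt (fun p => fderiv ℝ F p (0, 1)) _ (s, t) :=
        hd2.hasFDerivAt.clm_apply (hasFDerivAt_const ((0 : ℝ), (1 : ℝ)) (s, t))
      have h2 : HasFDerivAt A _ (s, t) := (I.hasFDerivAt.comp (s, t) h1).neg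
      rw [h2.fderiv]
      simp
    have hBd : fderiv ℝ (fun p => -I (B p)) (s, t) (0, 1) =
        -I (fderiv ℝ (fderiv ℝ F) (s, t) (0, 1) (1, 0)) := by
      have h1 : HasFDerivAt (fun p => fderiv ℝ F p (1, 0)) _ (s, t) :=
        hd2.hasFDerivAt.clm_apply (hasFDerivAt_const ((1 : ℝ), (0 : ℝ)) (s, t))
      have h2 : HasFDerivAt (fun p => -I (B p)) _ (s, t) := (I.hasFDerivAt.comp (s, t) h1).neg
      rw [h2.fderiv]
      simp
    rw [fderiv_inner_apply ℝ (hdiff hIB _ hp) (hdiff hF₁ _ hp),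
      fderiv_inner_apply ℝ (hdiff hA _ hp) (hdiff hF₁ _ hp), hAd, hBd, hsymm.eq]
    simp only [hAdef, hBdef, inner_neg_left, hskew]
    have hswap := (real_inner_comm (I (fderiv ℝ F (s, t) (0, 1))) (fderiv ℝ F (s, t) (1, 0))).trans
      (hskew (fderiv ℝ F (s, t) (0, 1)) (fderiv ℝ F (s, t) (1, 0)))
    linarith
  simp only [← real_inner_self_eq_norm_sq]
  refine exists_exp_lower_bound hK hff hDD ?_ ?_ ?_ hs₀ ?_
  · intro s hs
    exact intervalIntegral.integral_nonneg hτb.le fun t _ => real_inner_self_nonneg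
  · intro s hs
    simp only [← intervalIntegral.integral_const_mul]
    rw [← intervalIntegral.integral_add ((hii hA hF₁ s hs).const_mul _)
      ((hii hF₁ hF₁ s hs).const_mul _)]
    refine intervalIntegral.integral_mono_on hτb.le ((hii hFs hF₁ s hs).const_mul _)
      (((hii hA hF₁ s hs).const_mul _).add ((hii hF₁ hF₁ s hs).const_mul _)) fun t _ => ?_
    have h1 := hE (s, t) ⟨hs, trivial⟩
    have h2 := real_inner_le_norm (B (s, t) - A (s, t)) (F (s, t))
    rw [inner_sub_left] at h2
    have h3 : ‖B (s, t) - A (s, t)‖ ≤ K * Real.exp s * ‖F (s, t)‖ := by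
      simpa [hAdef, hBdef] using h1
    rw [real_inner_self_eq_norm_sq]
    nlinarith [mul_le_mul_of_nonneg_right h3 (norm_nonneg (F (s, t)))]
  · intro s hs hpos
    set f := ∫ t in τ..b, inner ℝ (F (s, t)) (F (s, t)) with hf
    set D := ∫ t in τ..b, inner ℝ (A (s, t)) (F (s, t)) with hD
    set N := D / f with hN
    have hDN : D = N * f := by rw [hN]; field_simp
    simp only [intervalIntegral.integral_const_mul]
    have hmono : ∫ t in τ..b, -(K ^ 2 / 4 * Real.exp (2 * s)) * inner ℝ (F (s, t)) (F (s, t)) ≤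
        ∫ t in τ..b, (inner ℝ (A (s, t)) (B (s, t)) - N * inner ℝ (B (s, t)) (F (s, t)) -
          N * inner ℝ (A (s, t)) (F (s, t)) + N ^ 2 * inner ℝ (F (s, t)) (F (s, t))) := by
      refine intervalIntegral.integral_mono_on hτb.le ((hii hF₁ hF₁ s hs).const_mul _)
        ((((hii hA hFs s hs).sub ((hii hFs hF₁ s hs).const_mul _)).sub
          ((hii hA hF₁ s hs).const_mul _)).add ((hii hF₁ hF₁ s hs).const_mul _)) fun t _ => ?_
      have h3 : ‖B (s, t) - A (s, t)‖ ≤ K * Real.exp s * ‖F (s, t)‖ := by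
        simpa [hAdef, hBdef] using hE (s, t) ⟨hs, trivial⟩
      have h4 : ‖B (s, t) - A (s, t)‖ ^ 2 ≤ (K * Real.exp s * ‖F (s, t)‖) ^ 2 := by gcongr
      have h5 : (K * Real.exp s * ‖F (s, t)‖) ^ 2 =
          K ^ 2 * Real.exp (2 * s) * inner ℝ (F (s, t)) (F (s, t)) := by
        rw [real_inner_self_eq_norm_sq, two_mul, Real.exp_add]; ring
      have h6 : 0 ≤ ‖(A (s, t) - N • F (s, t)) + (2⁻¹ : ℝ) • (B (s, t) - A (s, t))‖ ^ 2 := by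
        positivity
      rw [h5, ← real_inner_self_eq_norm_sq] at h4
      rw [← real_inner_self_eq_norm_sq] at h6
      simp only [inner_add_left, inner_add_right, inner_sub_left, inner_sub_right,
        real_inner_smul_left, real_inner_smul_right] at h4 h6
      rw [real_inner_comm (B (s, t)) (A (s, t))] at *
      rw [real_inner_comm (F (s, t)) (A (s, t)), real_inner_comm (F (s, t)) (B (s, t))] at *
      nlinarith
    rw [intervalIntegral.integral_add (((hii hA hFs s hs).sub ((hii hFs hF₁ s hs).const_mul _)).sub
          ((hii hA hF₁ s hs).const_mul _)) ((hii hF₁ hF₁ s hs).const_mul _),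
      intervalIntegral.integral_sub ((hii hA hFs s hs).sub ((hii hFs hF₁ s hs).const_mul _))
          ((hii hA hF₁ s hs).const_mul _),
      intervalIntegral.integral_sub (hii hA hFs s hs) ((hii hFs hF₁ s hs).const_mul _)] at hmono
    simp only [intervalIntegral.integral_const_mul] at hmono
    rw [← hf, ← hD] at hmono
    rw [hDN] at hmono ⊢
    nlinarith [mul_le_mul_of_nonneg_right hmono hpos.le]
  · refine intervalIntegral.integral_pos hτb
      (continuous_slice_of_continuousOn (hF₁.inner ℝ hF₁).continuousOn hs₀).continuousOn
      (fun t _ => real_inner_self_nonneg) ⟨τ, Set.left_mem_Icc.2 hτb.le, ?_⟩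
    exact real_inner_self_pos.2 hne

/-- Strong unique continuation for `|∂ₛu + I ∂ₜu| ≤ C |u|` on a disc: a solution vanishing to
infinite order at the centre vanishes identically. -/
theorem eqOn_zero_of_norm_dbar_le {E : Type*} [NormedAddCommGroup E] [InnerProductSpace ℝ E]
    (I : E →L[ℝ] E) (hIsq : ∀ x, I (I x) = -x)
    (hskew : ∀ x y, inner ℝ (I x) y = -inner ℝ x (I y))
    {u : ℂ → E} {z₀ : ℂ} {R C : ℝ} (hC : 0 ≤ C) (hu : ContDiffOn ℝ 2 u (ball z₀ R))
    (hbound : ∀ z ∈ ball z₀ R,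
      ‖fderiv ℝ u z 1 + I (fderiv ℝ u z Complex.I)‖ ≤ C * ‖u z‖)
    (hflat : ∀ m : ℕ, u =O[nhds z₀] fun z => ‖z - z₀‖ ^ m) :
    Set.EqOn u 0 (ball z₀ R) := by
  intro z hz
  by_contra hne
  change u z ≠ 0 at hne
  have hR : 0 < R := dist_nonneg.trans_lt (mem_ball.1 hz)
  have hzz : z - z₀ ≠ 0 := by
    intro h
    obtain ⟨c, hc⟩ := (hflat 1).bound
    have := hc.self_of_nhds
    rw [sub_eq_zero.1 h] at hne
    simp at this
    exact hne this
  set e : ℝ × ℝ → ℂ := fun p => z₀ + Complex.exp (p.1 + p.2 * Complex.I) with he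
  set w : ℝ × ℝ → ℂ := fun p => Complex.exp (p.1 + p.2 * Complex.I) with hw
  have hnw : ∀ p, ‖w p‖ = Real.exp p.1 := by
    intro p
    simp [hw, Complex.norm_exp]
  have hecd : ContDiff ℝ 2 e := by
    have h1 : ContDiff ℝ 2 (fun p : ℝ × ℝ => (p.1 : ℂ) + p.2 * Complex.I) :=
      (Complex.ofRealCLM.contDiff.comp contDiff_fst).add
        ((Complex.ofRealCLM.contDiff.comp contDiff_snd).mul contDiff_const)
    exact contDiff_const.add ((Complex.contDiff_exp (𝕜 := ℝ)).comp h1)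
  have hed : ∀ p v, fderiv ℝ e p v = w p * (v.1 + v.2 * Complex.I) := by
    intro p v
    have h1 : HasFDerivAt (fun p : ℝ × ℝ => (p.1 : ℂ) + p.2 * Complex.I) _ p :=
      (Complex.ofRealCLM.hasFDerivAt.comp p hasFDerivAt_fst).add
        ((Complex.ofRealCLM.hasFDerivAt.comp p hasFDerivAt_snd).mul_const Complex.I)
    have h2 : HasFDerivAt e _ p := (h1.cexp).const_add z₀
    rw [h2.fderiv]
    simp [hw]
    ring
  have hmaps : ∀ p ∈ Set.Iio (Real.log R) ×ˢ (Set.univ : Set ℝ), e p ∈ ball z₀ R := by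
    intro p hp
    rw [mem_ball, dist_eq_norm, he]
    simp only [add_sub_cancel_left]
    change ‖w p‖ < R
    rw [hnw]
    exact (Real.lt_log_iff_exp_lt hR).1 hp.1
  have hF : ContDiffOn ℝ 2 (u ∘ e) (Set.Iio (Real.log R) ×ˢ Set.univ) :=
    hu.comp hecd.contDiffOn hmaps
  have hper : ∀ p, (u ∘ e) (p + (0, 2 * Real.pi)) = (u ∘ e) p := by
    intro p
    have : e (p + (0, 2 * Real.pi)) = e p := by
      simp only [he, Prod.fst_add, Prod.snd_add, add_zero]
      push_cast
      rw [add_mul, ← add_assoc, Complex.exp_periodic]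
    simp [this]
  have hnormI : ∀ x, ‖I x‖ = ‖x‖ := by
    intro x
    have h := hskew x (I x)
    rw [hIsq, inner_neg_right, neg_neg, real_inner_self_eq_norm_sq,
      real_inner_self_eq_norm_sq] at h
    exact (sq_eq_sq₀ (norm_nonneg _) (norm_nonneg _)).1 h
  have hE : ∀ p ∈ Set.Iio (Real.log R) ×ˢ (Set.univ : Set ℝ),
      ‖fderiv ℝ (u ∘ e) p (1, 0) + I (fderiv ℝ (u ∘ e) p (0, 1))‖ ≤
        2 * C * Real.exp p.1 * ‖(u ∘ e) p‖ := by
    intro p hp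
    have hb := hmaps p hp
    have hud : DifferentiableAt ℝ u (e p) :=
      (hu.differentiableOn two_ne_zero).differentiableAt (isOpen_ball.mem_nhds hb)
    rw [fderiv_comp p hud (hecd.differentiable two_ne_zero p)]
    simp only [ContinuousLinearMap.comp_apply, hed]
    set L := fderiv ℝ u (e p)
    set X := L 1 + I (L Complex.I) with hX
    have hL : ∀ ζ : ℂ, L ζ = ζ.re • L 1 + ζ.im • L Complex.I := by
      intro ζ
      rw [← map_smul, ← map_smul, ← map_add]
      congr 1
      simp [Complex.re_add_im]
    have hsum : L (w p * ((1 : ℝ) + (0 : ℝ) * Complex.I)) +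
        I (L (w p * ((0 : ℝ) + (1 : ℝ) * Complex.I))) = (w p).re • X - (w p).im • I X := by
      rw [hL, hL (w p * ((0 : ℝ) + (1 : ℝ) * Complex.I))]
      simp only [hX, map_add, map_smul, hIsq]
      simp
      module
    rw [hsum]
    have h1 : ‖X‖ ≤ C * ‖u (e p)‖ := hbound _ hb
    calc ‖(w p).re • X - (w p).im • I X‖ ≤ |(w p).re| * ‖X‖ + |(w p).im| * ‖X‖ := by
          refine (norm_sub_le _ _).trans ?_
          rw [norm_smul, norm_smul, hnormI, Real.norm_eq_abs, Real.norm_eq_abs]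
      _ ≤ Real.exp p.1 * ‖X‖ + Real.exp p.1 * ‖X‖ := by
          rw [← hnw]
          gcongr
          · exact Complex.abs_re_le_norm _
          · exact Complex.abs_im_le_norm _
      _ ≤ Real.exp p.1 * (C * ‖u (e p)‖) + Real.exp p.1 * (C * ‖u (e p)‖) := by gcongr
      _ = 2 * C * Real.exp p.1 * ‖(u ∘ e) p‖ := by simp; ring
  have hpolar : e (Real.log ‖z - z₀‖, Complex.arg (z - z₀)) = z := by
    have h1 := Complex.exp_log hzz
    simp only [he]
    rw [Complex.log] at h1
    rw [h1]; ring
  have hs₀ : Real.log ‖z - z₀‖ < Real.log R :=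
    Real.log_lt_log (norm_pos_iff.2 hzz) (by simpa [dist_eq_norm] using hz)
  obtain ⟨M, c, hc, hlow⟩ := exists_exp_lower_bound_integral_norm_sq I hskew
    (by positivity : (0 : ℝ) ≤ 2 * C) hF hper hE (τ := Complex.arg (z - z₀)) hs₀
    (by simpa [hpolar] using hne)
  obtain ⟨m, hm⟩ := exists_nat_gt M
  obtain ⟨c', hc', hO⟩ := (hflat m).exists_pos
  rw [Asymptotics.IsBigOWith, Metric.eventually_nhds_iff] at hO
  obtain ⟨δ, hδ, hO⟩ := hO
  set τ := Complex.arg (z - z₀)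
  have hup : ∀ᶠ s : ℝ in atBot, c * Real.exp (M * s) ≤
      c' ^ 2 * Real.exp (2 * m * s) * (2 * Real.pi) := by
    filter_upwards [eventually_le_atBot (Real.log ‖z - z₀‖), eventually_lt_atBot (Real.log δ)]
      with s hs hsδ
    refine (hlow s hs).trans ?_
    have hpt : ∀ t ∈ Set.uIoc τ (τ + 2 * Real.pi),
        ‖‖(u ∘ e) (s, t)‖ ^ 2‖ ≤ c' ^ 2 * Real.exp (2 * m * s) := by
      intro t _
      have hd : ‖e (s, t) - z₀‖ = Real.exp s := by
        rw [← hnw (s, t)]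
        simp [he, hw]
      have h := @hO (e (s, t)) (by
        rw [dist_eq_norm, hd]; exact (Real.lt_log_iff_exp_lt hδ).1 hsδ)
      rw [hd, norm_pow, Real.norm_of_nonneg (Real.exp_pos s).le, ← Real.exp_nat_mul] at h
      rw [Real.norm_of_nonneg (by positivity)]
      calc ‖(u ∘ e) (s, t)‖ ^ 2 ≤ (c' * Real.exp (m * s)) ^ 2 := by gcongr; exact h
        _ = c' ^ 2 * Real.exp (2 * m * s) := by
          rw [mul_pow, ← Real.exp_nat_mul]; push_cast; ring_nf
    have := intervalIntegral.norm_integral_le_of_norm_le_const hpt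
    rw [add_sub_cancel_left, abs_of_nonneg Real.two_pi_pos.le] at this
    exact (le_abs_self _).trans this
  have hlim : Tendsto (fun s : ℝ => c' ^ 2 * (2 * Real.pi) * Real.exp ((2 * m - M) * s)) atBot
      (nhds (c' ^ 2 * (2 * Real.pi) * 0)) := by
    refine (Real.tendsto_exp_atBot.comp ?_).const_mul _
    refine tendsto_id.const_mul_atBot ?_
    have : (0 : ℝ) ≤ m := m.cast_nonneg
    linarith
  have hcle : c ≤ c' ^ 2 * (2 * Real.pi) * 0 := by
    refine ge_of_tendsto hlim ?_
    filter_upwards [hup] with s hs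
    have h := mul_le_mul_of_nonneg_right hs (Real.exp_pos (-(M * s))).le
    rw [mul_assoc, ← Real.exp_add, add_neg_cancel, Real.exp_zero, mul_one] at h
    refine h.trans_eq ?_
    rw [sub_mul, sub_eq_add_neg, Real.exp_add]; ring
  linarith

theorem isBigO_pow_of_iteratedFDeriv_eq_zero {G : Type*} [NormedAddCommGroup G]
    [NormedSpace ℝ G] {f : ℂ → G} {s : Set ℂ} (hs : IsOpen s) {x : ℂ} (hx : x ∈ s)
    (hf : ContDiffOn ℝ (⊤ : ℕ∞) f s) (m : ℕ) (h : ∀ j < m, iteratedFDeriv ℝ j f x = 0) :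
    f =O[nhds x] fun z => ‖z - x‖ ^ m := by
  induction m generalizing G with
  | zero =>
    simpa using (hf.continuousOn.continuousAt (hs.mem_nhds hx)).tendsto.isBigO_one ℝ
  | succ m ih =>
    have hd : ContDiffOn ℝ (⊤ : ℕ∞) (fderiv ℝ f) s := hf.fderiv_of_isOpen hs (by simp)
    have hO := ih hd fun j hj => by
      rw [← norm_eq_zero, norm_iteratedFDeriv_fderiv, norm_eq_zero]
      exact h (j + 1) (by omega)
    have hfx : f x = 0 := by
      have := congrArg (fun p => p 0) (h 0 (by omega))
      simpa using this
    obtain ⟨c, hc₀, hc⟩ := hO.exists_nonneg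
    obtain ⟨δ, hδ, hball⟩ := Metric.eventually_nhds_iff_ball.1 (hc.bound.and (hs.mem_nhds hx))
    refine Asymptotics.IsBigO.of_bound c ?_
    filter_upwards [ball_mem_nhds x hδ] with z hz
    have hsub : closedBall x ‖z - x‖ ⊆ ball x δ :=
      closedBall_subset_ball (by rwa [← dist_eq_norm])
    have hmv := (convex_closedBall x ‖z - x‖).norm_image_sub_le_of_norm_fderiv_le
      (𝕜 := ℝ) (f := f) (C := c * ‖z - x‖ ^ m) (x := x) (y := z) ?_ ?_
      (mem_closedBall_self (norm_nonneg _)) (by simp [dist_eq_norm])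
    · rw [hfx, sub_zero] at hmv
      simpa [pow_succ, mul_assoc] using hmv
    · intro y hy
      exact (hf.differentiableOn (by simp)).differentiableAt (hs.mem_nhds (hball y (hsub hy)).2)
    · intro y hy
      have hy' := (hball y (hsub hy)).1
      rw [norm_pow, norm_norm] at hy'
      refine hy'.trans ?_
      gcongr
      simpa [dist_eq_norm] using hy

section UniqueContinuation

variable {V : Type*} [NormedAddCommGroup V] [InnerProductSpace ℝ V]

theorem eventuallyEq_zero_of_iteratedFDeriv_eq_zero {J : V → V →L[ℝ] V} (hJ : ContDiff ℝ 1 J)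
    (hJsq : ∀ x, J 0 (J 0 x) = -x)
    (hskew : ∀ x y, inner ℝ (J 0 x) y = -inner ℝ x (J 0 y))
    {u : ℂ → V} {s : Set ℂ} (hs : IsOpen s) (hu : ContDiffOn ℝ (⊤ : ℕ∞) u s)
    (hCR : ∀ z ∈ s, fderiv ℝ u z 1 + J (u z) (fderiv ℝ u z Complex.I) = 0)
    {z₀ : ℂ} (hz₀ : z₀ ∈ s) (hflat : ∀ j, iteratedFDeriv ℝ j u z₀ = 0) :
    u =ᶠ[nhds z₀] 0 := by
  have hu₀ : u z₀ = 0 := by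
    have := congrArg (fun p => p 0) (hflat 0)
    simpa using this
  have hcont : ContinuousAt u z₀ := hu.continuousOn.continuousAt (hs.mem_nhds hz₀)
  obtain ⟨L, t, ht, hL⟩ := (hJ.contDiffAt (x := (0 : V))).exists_lipschitzOnWith
  have hd : ContinuousAt (fun z => ‖fderiv ℝ u z Complex.I‖) z₀ :=
    (((hu.continuousOn_fderiv_of_isOpen hs (by simp)).continuousAt
      (hs.mem_nhds hz₀)).clm_apply continuousAt_const).norm
  set B := ‖fderiv ℝ u z₀ Complex.I‖ + 1
  have hev : ∀ᶠ z in nhds z₀,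
      ‖fderiv ℝ u z 1 + J 0 (fderiv ℝ u z Complex.I)‖ ≤ (L * B) * ‖u z‖ := by
    rw [← hu₀] at ht
    filter_upwards [hs.mem_nhds hz₀, hcont ht,
      hd.eventually_lt continuousAt_const (lt_add_one _)] with z hz hzt hzB
    have h1 : fderiv ℝ u z 1 + J 0 (fderiv ℝ u z Complex.I) =
        (J 0 - J (u z)) (fderiv ℝ u z Complex.I) := by
      rw [sub_apply, eq_sub_iff_add_eq, add_right_comm, hCR z hz, zero_add]
    have h2 : ‖J 0 - J (u z)‖ ≤ L * ‖u z‖ := by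
      have := hL.norm_sub_le (mem_of_mem_nhds (hu₀ ▸ ht)) hzt
      simpa using this
    rw [h1]
    calc _ ≤ ‖J 0 - J (u z)‖ * ‖fderiv ℝ u z Complex.I‖ := ContinuousLinearMap.le_opNorm _ _
      _ ≤ (L * ‖u z‖) * B := by gcongr
      _ = _ := by ring
  obtain ⟨R, hR, hball⟩ := Metric.eventually_nhds_iff_ball.1 (hev.and (hs.mem_nhds hz₀))
  have hzero := eqOn_zero_of_norm_dbar_le (J 0) hJsq hskew (u := u) (z₀ := z₀) (R := R)
    (C := L * B) (by positivity)
    ((hu.of_le (WithTop.coe_le_coe.2 (le_top : (2 : ℕ∞) ≤ ⊤))).mono fun z hz => (hball z hz).2)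
    (fun z hz => (hball z hz).1)
    (fun m => isBigO_pow_of_iteratedFDeriv_eq_zero hs hz₀ hu m fun j _ => hflat j)
  filter_upwards [ball_mem_nhds z₀ hR] with z hz using hzero hz

/-- A `J`-holomorphic curve on a connected domain all of whose derivatives vanish at one point is
identically zero. -/
theorem eqOn_zero_of_iteratedFDeriv_eq_zero {J : V → V →L[ℝ] V} (hJ : ContDiff ℝ 1 J)
    (hJsq : ∀ x, J 0 (J 0 x) = -x)
    (hskew : ∀ x y, inner ℝ (J 0 x) y = -inner ℝ x (J 0 y))
    {u : ℂ → V} {s : Set ℂ} (hs : IsOpen s) (hconn : IsPreconnected s)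
    (hu : ContDiffOn ℝ (⊤ : ℕ∞) u s)
    (hCR : ∀ z ∈ s, fderiv ℝ u z 1 + J (u z) (fderiv ℝ u z Complex.I) = 0)
    {z₀ : ℂ} (hz₀ : z₀ ∈ s) (hflat : ∀ j, iteratedFDeriv ℝ j u z₀ = 0) :
    Set.EqOn u 0 s := by
  have hsub : s ⊆ {z | u =ᶠ[nhds z] 0} := by
    refine hconn.subset_of_closure_inter_subset
      (isOpen_iff_mem_nhds.2 fun z hz => eventually_eventually_nhds.2 hz)
      ⟨z₀, hz₀, eventuallyEq_zero_of_iteratedFDeriv_eq_zero hJ hJsq hskew hs hu hCR hz₀ hflat⟩ ?_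
    rintro z ⟨hzc, hzs⟩
    refine eventuallyEq_zero_of_iteratedFDeriv_eq_zero hJ hJsq hskew hs hu hCR hzs fun j => ?_
    have hc : ContinuousAt (iteratedFDeriv ℝ j u) z :=
      ((hu.continuousOn_iteratedFDerivWithin (m := j) (by exact_mod_cast le_top)
        hs.uniqueDiffOn).congr
        (iteratedFDerivWithin_of_isOpen j hs).symm).continuousAt (hs.mem_nhds hzs)
    by_contra hne
    obtain ⟨y, hy, hyz⟩ := mem_closure_iff_nhds.1 hzc _ (hc.eventually_ne hne)
    apply hy
    rw [(EventuallyEq.iteratedFDeriv ℝ hyz j).self_of_nhds]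
    have := congrFun (iteratedFDeriv_fun_zero (𝕜 := ℝ) (E := ℂ) (F := V) (n := j)) y
    exact this
  exact fun z hz => (hsub hz).self_of_nhds

end UniqueContinuation

section LeadingTerm

variable {V : Type*} [NormedAddCommGroup V] [NormedSpace ℝ V] [NormedSpace ℂ V]
  [IsScalarTower ℝ ℂ V]

/-- If `∂ₜf - i ∂ₛf` vanishes to order `k` at `x`, then the `k`-th derivative of `f` at `x` is
complex multilinear. -/
theorem iteratedFDeriv_apply_eq_prod_smul {f : ℂ → V} {s : Set ℂ} (hs : IsOpen s) {x : ℂ}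
    (hx : x ∈ s) (hf : ContDiffOn ℝ (⊤ : ℕ∞) f s) (k : ℕ)
    (h : ∀ j < k, iteratedFDeriv ℝ j
      (fun z => fderiv ℝ f z Complex.I - Complex.I • fderiv ℝ f z 1) x = 0)
    (v : Fin k → ℂ) :
    iteratedFDeriv ℝ k f x v = (∏ i, v i) • iteratedFDeriv ℝ k f x fun _ => 1 := by
  induction k generalizing f with
  | zero => simp
  | succ k ih =>
    have hd : ContDiffOn ℝ (⊤ : ℕ∞) (fderiv ℝ f) s := hf.fderiv_of_isOpen hs (by simp)
    have hdat : ∀ z ∈ s, ContDiffAt ℝ (⊤ : ℕ∞) (fderiv ℝ f) z :=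
      fun z hz => hd.contDiffAt (hs.mem_nhds hz)
    have hle : ∀ j : ℕ, (j : WithTop ℕ∞) ≤ ((⊤ : ℕ∞) : WithTop ℕ∞) :=
      fun j => by exact_mod_cast le_top
    let P : (ℂ →L[ℝ] V) →L[ℝ] V := ContinuousLinearMap.apply ℝ V (1 : ℂ)
    let iV : V →L[ℝ] V := (Complex.I • ContinuousLinearMap.id ℂ V).restrictScalars ℝ
    let L : (ℂ →L[ℝ] V) →L[ℝ] V :=
      ContinuousLinearMap.apply ℝ V Complex.I - iV ∘L P
    have hL : ∀ T, L T = T Complex.I - Complex.I • T 1 := fun T => rfl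
    have hP : ∀ T, P T = T 1 := fun T => rfl
    have hR : (fun z => fderiv ℝ f z Complex.I - Complex.I • fderiv ℝ f z 1) =
        L ∘ fderiv ℝ f := rfl
    rw [hR] at h
    have hg : ContDiffOn ℝ (⊤ : ℕ∞) (P ∘ fderiv ℝ f) s := P.contDiff.comp_contDiffOn hd
    have hstep : ∀ w, iteratedFDeriv ℝ k (P ∘ fderiv ℝ f) x w =
        iteratedFDeriv ℝ k (fderiv ℝ f) x w 1 := by
      intro w
      rw [P.iteratedFDeriv_comp_left (hdat x hx) (hle k)]
      rfl
    have hev : (fun z => fderiv ℝ (P ∘ fderiv ℝ f) z Complex.I -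
        Complex.I • fderiv ℝ (P ∘ fderiv ℝ f) z 1) =ᶠ[nhds x]
          P ∘ fderiv ℝ (L ∘ fderiv ℝ f) := by
      filter_upwards [hs.mem_nhds hx] with z hz
      have hdz : DifferentiableAt ℝ (fderiv ℝ f) z := (hdat z hz).differentiableAt (by simp)
      have hsymm : IsSymmSndFDerivAt ℝ f z :=
        (hf.contDiffAt (hs.mem_nhds hz)).isSymmSndFDerivAt
          (by simpa using WithTop.coe_le_coe.2 (le_top : (2 : ℕ∞) ≤ ⊤))
      have h1 : fderiv ℝ (P ∘ fderiv ℝ f) z = P ∘L fderiv ℝ (fderiv ℝ f) z :=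
        (P.hasFDerivAt.comp z hdz.hasFDerivAt).fderiv
      have h2 : fderiv ℝ (L ∘ fderiv ℝ f) z = L ∘L fderiv ℝ (fderiv ℝ f) z :=
        (L.hasFDerivAt.comp z hdz.hasFDerivAt).fderiv
      simp only [Function.comp_apply, h1, h2, ContinuousLinearMap.comp_apply, hP, hL]
      rw [hsymm.eq]
    have hprod := ih hg (fun j hj => by
      rw [(EventuallyEq.iteratedFDeriv ℝ hev j).self_of_nhds,
        P.iteratedFDeriv_comp_left (n := (⊤ : ℕ∞))
        (((L.contDiff.comp_contDiffOn hd).fderiv_of_isOpen hs (by simp)).contDiffAt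
          (hs.mem_nhds hx)) (hle j)]
      have h0 : iteratedFDeriv ℝ j (fderiv ℝ (L ∘ fderiv ℝ f)) x = 0 := by
        rw [← norm_eq_zero, norm_iteratedFDeriv_fderiv, norm_eq_zero]
        exact h (j + 1) (by omega)
      rw [h0]
      ext; simp) (Fin.init v)
    have hI : iteratedFDeriv ℝ k (fderiv ℝ f) x (Fin.init v) Complex.I =
        Complex.I • iteratedFDeriv ℝ k (fderiv ℝ f) x (Fin.init v) 1 := by
      have h0 := h k (by omega)
      rw [L.iteratedFDeriv_comp_left (hdat x hx) (hle k)] at h0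
      exact sub_eq_zero.1 (congrArg (fun p => p (Fin.init v)) h0)
    have hlin : ∀ (T : ℂ →L[ℝ] V) (ζ : ℂ), T Complex.I = Complex.I • T 1 → T ζ = ζ • T 1 := by
      intro T ζ hT
      have : T ζ = ζ.re • T 1 + ζ.im • T Complex.I := by
        rw [← map_smul, ← map_smul, ← map_add]
        congr 1
        simp [Complex.re_add_im]
      rw [this, hT, ← algebraMap_smul ℂ ζ.re, ← algebraMap_smul ℂ ζ.im, smul_smul, ← add_smul]
      simp [Complex.re_add_im]
    rw [iteratedFDeriv_succ_apply_right, iteratedFDeriv_succ_apply_right, hlin _ _ hI, ← hstep,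
      hprod, hstep, smul_smul, Fin.prod_univ_castSucc, mul_comm]
    rfl

/-- If a `J`-holomorphic curve vanishes to order `k` at `x`, then it satisfies the Cauchy–Riemann
equation for `J 0` to order `k` at `x`. -/
theorem iteratedFDeriv_dbar_eq_zero {J : V → V →L[ℝ] V} (hJ : ContDiff ℝ (⊤ : ℕ∞) J)
    (hJ0 : ∀ w, J 0 w = Complex.I • w)
    {u : ℂ → V} {s : Set ℂ} (hs : IsOpen s) (hu : ContDiffOn ℝ (⊤ : ℕ∞) u s)
    (hCR : ∀ z ∈ s, fderiv ℝ u z 1 + J (u z) (fderiv ℝ u z Complex.I) = 0)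
    {x : ℂ} (hx : x ∈ s) (hux : u x = 0) {k : ℕ}
    (hk : ∀ j < k, iteratedFDeriv ℝ j u x = 0) {j : ℕ} (hj : j < k) :
    iteratedFDeriv ℝ j (fun z => fderiv ℝ u z Complex.I - Complex.I • fderiv ℝ u z 1) x = 0 := by
  have hle : ∀ j : ℕ, (j : WithTop ℕ∞) ≤ ((⊤ : ℕ∞) : WithTop ℕ∞) :=
    fun j => by exact_mod_cast le_top
  let iV : V →L[ℝ] V := (Complex.I • ContinuousLinearMap.id ℂ V).restrictScalars ℝ
  let h : V → V →L[ℝ] V := fun y => iV ∘L (J y - J 0)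
  have hh : ContDiff ℝ (⊤ : ℕ∞) h := contDiff_const.clm_comp (hJ.sub contDiff_const)
  have hev : (fun z => fderiv ℝ u z Complex.I - Complex.I • fderiv ℝ u z 1) =ᶠ[nhds x]
      fun z => (h ∘ u) z (fderiv ℝ u z Complex.I) := by
    filter_upwards [hs.mem_nhds hx] with z hz
    have h1 : fderiv ℝ u z 1 = -J (u z) (fderiv ℝ u z Complex.I) :=
      eq_neg_of_add_eq_zero_left (hCR z hz)
    change _ = Complex.I • (J (u z) (fderiv ℝ u z Complex.I) - J 0 (fderiv ℝ u z Complex.I))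
    rw [h1, hJ0, smul_sub, smul_smul, Complex.I_mul_I, smul_neg, sub_neg_eq_add, neg_one_smul]
    abel
  have hcomp : ∀ i < k, ‖iteratedFDerivWithin ℝ i (h ∘ u) s x‖ = 0 := by
    intro i hi
    rcases Nat.eq_zero_or_pos i with rfl | hi₀
    · rw [norm_iteratedFDerivWithin_zero, Function.comp_apply, hux]
      simp [h]
    · have := norm_iteratedFDerivWithin_comp_le (n := i) (N := (⊤ : ℕ∞)) (D := 0)
        (C := ∑ l ∈ Finset.range (i + 1), ‖iteratedFDerivWithin ℝ l h Set.univ (u x)‖)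
        hh.contDiffOn hu (hle i) uniqueDiffOn_univ hs.uniqueDiffOn (Set.mapsTo_univ _ _) hx
        (fun l hl => Finset.single_le_sum
          (f := fun l => ‖iteratedFDerivWithin ℝ l h Set.univ (u x)‖)
          (fun _ _ => norm_nonneg _) (Finset.mem_range.2 (by omega)))
        (fun l hl hl' => by
          rw [iteratedFDerivWithin_of_isOpen l hs hx, hk l (by omega), norm_zero]
          positivity)
      rw [zero_pow hi₀.ne', mul_zero] at this
      exact le_antisymm this (norm_nonneg _)
  rw [(EventuallyEq.iteratedFDeriv ℝ hev j).self_of_nhds,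
    ← norm_le_zero_iff, ← iteratedFDerivWithin_of_isOpen j hs hx]
  refine (norm_iteratedFDerivWithin_clm_apply (N := (⊤ : ℕ∞)) (hh.comp_contDiffOn hu)
    ((hu.fderiv_of_isOpen hs (by simp)).clm_apply contDiffOn_const) hs.uniqueDiffOn hx
    (hle j)).trans_eq ?_
  refine Finset.sum_eq_zero fun i hi => ?_
  rw [hcomp i (by have := Finset.mem_range.1 hi; omega), mul_zero, zero_mul]

end LeadingTerm

/-- The leading Taylor term along a ray of a map vanishing to order `k` at the origin. -/
theorem tendsto_inv_pow_smul_of_iteratedFDeriv_eq_zero {E F : Type*} [NormedAddCommGroup E]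
    [NormedSpace ℝ E] [NormedAddCommGroup F] [NormedSpace ℝ F] {f : E → F} {s : Set E}
    (hs : IsOpen s) (hconv : Convex ℝ s) (h₀ : (0 : E) ∈ s) {k : ℕ} (hf : ContDiffOn ℝ k f s)
    (hk : ∀ j < k, iteratedFDeriv ℝ j f 0 = 0) (v : E) :
    Tendsto (fun ε : ℝ => (ε ^ k)⁻¹ • f (ε • v)) (nhdsWithin 0 (Set.Ioi 0))
      (nhds ((k.factorial : ℝ)⁻¹ • iteratedFDeriv ℝ k f 0 fun _ => v)) := by
  let g : ℝ →L[ℝ] E := ContinuousLinearMap.toSpanSingleton ℝ v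
  have hg₀ : g 0 ∈ s := by simpa using h₀
  have hopen : IsOpen (g ⁻¹' s) := hs.preimage g.continuous
  have hd : ∀ j ≤ k, iteratedDerivWithin j (f ∘ g) (g ⁻¹' s) 0 =
      iteratedFDeriv ℝ j f 0 fun _ => v := by
    intro j hj
    rw [iteratedDerivWithin_eq_iteratedFDerivWithin,
      g.iteratedFDerivWithin_comp_right hf hs.uniqueDiffOn hopen.uniqueDiffOn hg₀
        (by exact_mod_cast hj), map_zero, iteratedFDerivWithin_of_isOpen j hs h₀]
    simp [g]
  have ht := taylor_tendsto (s := g ⁻¹' s) (hconv.linear_preimage g.toLinearMap) hg₀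
    (hf.comp g.contDiff.contDiffOn (Set.mapsTo_preimage g s))
  have heval : ∀ ε, taylorWithinEval (f ∘ g) k (g ⁻¹' s) 0 ε =
      ε ^ k • (k.factorial : ℝ)⁻¹ • iteratedFDeriv ℝ k f 0 fun _ => v := by
    intro ε
    rw [taylor_within_apply, Finset.sum_range_succ, Finset.sum_eq_zero, zero_add, hd k le_rfl,
      sub_zero, smul_smul, mul_comm]
    intro j hj
    have hj' := Finset.mem_range.1 hj
    rw [hd j hj'.le, hk j hj', zero_apply, smul_zero]
  have ht' := (ht.mono_left (nhdsWithin_le_of_mem (mem_nhdsWithin_of_mem_nhds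
    (hopen.mem_nhds hg₀)) : nhdsWithin (0 : ℝ) (Set.Ioi 0) ≤ _)).add_const
      ((k.factorial : ℝ)⁻¹ • iteratedFDeriv ℝ k f 0 fun _ => v)
  rw [zero_add] at ht'
  refine ht'.congr' ?_
  filter_upwards [self_mem_nhdsWithin] with ε hε
  rw [heval, sub_zero, smul_sub, inv_smul_smul₀ (pow_ne_zero k (ne_of_gt hε)), sub_add_cancel]
  rfl

theorem le_of_tendsto_inv_pow_smul {V : Type*} [NormedAddCommGroup V]
    [NormedSpace ℝ V] {f : ℝ → V} {k l : ℕ} {a b : V} (hb : b ≠ 0)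
    (hk : Tendsto (fun ε : ℝ => (ε ^ k)⁻¹ • f ε) (nhdsWithin 0 (Set.Ioi 0)) (nhds a))
    (hl : Tendsto (fun ε : ℝ => (ε ^ l)⁻¹ • f ε) (nhdsWithin 0 (Set.Ioi 0)) (nhds b)) :
    k ≤ l := by
  by_contra! hlt
  have hpow : Tendsto (fun ε : ℝ => ε ^ (k - l)) (nhdsWithin 0 (Set.Ioi 0)) (nhds 0) := by
    have := ((continuous_pow (M := ℝ) (k - l)).tendsto 0).mono_left
      (nhdsWithin_le_nhds (s := Set.Ioi 0))
    rwa [zero_pow (Nat.sub_ne_zero_of_lt hlt)] at this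
  refine hb (tendsto_nhds_unique hl ?_)
  rw [← zero_smul ℝ a]
  refine (hpow.smul hk).congr' ?_
  filter_upwards [self_mem_nhdsWithin] with ε hε
  have hε₀ : ε ≠ 0 := ne_of_gt hε
  rw [smul_smul, pow_sub₀ ε hε₀ hlt.le]
  congr 1
  field_simp

/-- **Existence of a tangent space at a point of a pseudoholomorphic curve.**  Let `J` be
an almost complex structure on `ℂⁿ` with `J(0)` equal to multiplication by `i`, and let
`u : B → ℂⁿ` be a nonconstant smooth `J`-holomorphic curve with `u(0) = 0`.  Then there
exist a unique complex `1`-dimensional subspace `T ⊆ ℂⁿ` and a unique positive integer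
`k` such that for every `z ∈ B \ {0}` the limit of `ε^{-k}·u(εz)` as `ε → 0⁺` exists and
is a nonzero vector of `T`. -/
theorem pseudoholomorphic_tangent_space (n : ℕ)
    (J : EuclideanSpace ℂ (Fin n) →
      (EuclideanSpace ℂ (Fin n) →L[ℝ] EuclideanSpace ℂ (Fin n)))
    (hJsmooth : ContDiff ℝ (⊤ : ℕ∞) J)
    (hJsq : ∀ x w, J x (J x w) = -w)
    (hJ0 : ∀ w, J 0 w = Complex.I • w)
    (u : ℂ → EuclideanSpace ℂ (Fin n))
    (husmooth : ContDiffOn ℝ (⊤ : ℕ∞) u (ball 0 1))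
    (huCR : ∀ z ∈ ball (0 : ℂ) 1,
      fderiv ℝ u z 1 + J (u z) (fderiv ℝ u z Complex.I) = 0)
    (hu0 : u 0 = 0)
    (hnonconst : ∃ z ∈ ball (0 : ℂ) 1, ∃ w ∈ ball (0 : ℂ) 1, u z ≠ u w) :
    ∃! Tk : Submodule ℂ (EuclideanSpace ℂ (Fin n)) × ℕ,
      Module.finrank ℂ Tk.1 = 1 ∧ 0 < Tk.2 ∧
      ∀ z ∈ ball (0 : ℂ) 1 \ {0},
        ∃ w : EuclideanSpace ℂ (Fin n), w ≠ 0 ∧ w ∈ Tk.1 ∧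
          Tendsto (fun ε : ℝ => (ε ^ Tk.2)⁻¹ • u (ε • z))
            (nhdsWithin 0 (Set.Ioi 0)) (nhds w) := by
  have h₀ : (0 : ℂ) ∈ ball (0 : ℂ) 1 := mem_ball_self one_pos
  have hskew : ∀ x y, inner ℝ (J 0 x) y = -inner ℝ x (J 0 y) := by
    intro x y
    rw [hJ0, hJ0, PiLp.inner_apply, PiLp.inner_apply, ← Finset.sum_neg_distrib]
    refine Finset.sum_congr rfl fun i _ => ?_
    simp only [PiLp.smul_apply, smul_eq_mul, Complex.inner, map_mul, Complex.conj_I,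
      Complex.mul_re, Complex.mul_im, Complex.neg_re, Complex.neg_im, Complex.I_re, Complex.I_im,
      Complex.conj_re, Complex.conj_im]
    ring
  have hex : ∃ k, iteratedFDeriv ℝ k u 0 ≠ 0 := by
    by_contra! hflat
    obtain ⟨z, hz, w, hw, hne⟩ := hnonconst
    have hzero := eqOn_zero_of_iteratedFDeriv_eq_zero
      (hJsmooth.of_le (WithTop.coe_le_coe.2 (le_top : (1 : ℕ∞) ≤ ⊤))) (hJsq 0) hskew isOpen_ball
      (convex_ball _ _).isPreconnected husmooth huCR h₀ hflat
    exact hne ((hzero hz).trans (hzero hw).symm)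
  classical
  obtain ⟨k, hk, hmin⟩ : ∃ k, iteratedFDeriv ℝ k u 0 ≠ 0 ∧
      ∀ j < k, iteratedFDeriv ℝ j u 0 = 0 :=
    ⟨Nat.find hex, Nat.find_spec hex, fun j hj => not_not.1 (Nat.find_min hex hj)⟩
  have hkpos : 0 < k := by
    refine Nat.pos_of_ne_zero fun h => hk ?_
    subst h
    refine ContinuousMultilinearMap.ext fun v => ?_
    rw [iteratedFDeriv_zero_apply, hu0, zero_apply]
  let w₁ := iteratedFDeriv ℝ k u 0 fun _ => 1
  have happly : ∀ v, iteratedFDeriv ℝ k u 0 v = (∏ i, v i) • w₁ :=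
    iteratedFDeriv_apply_eq_prod_smul isOpen_ball h₀ husmooth k fun j hj =>
      iteratedFDeriv_dbar_eq_zero hJsmooth hJ0 isOpen_ball husmooth huCR h₀ hu0 hmin hj
  have hw₁0 : w₁ ≠ 0 := by
    intro h
    refine hk (ContinuousMultilinearMap.ext fun v => ?_)
    rw [happly, h, smul_zero, zero_apply]
  have hlim : ∀ z : ℂ, Tendsto (fun ε : ℝ => (ε ^ k)⁻¹ • u (ε • z))
      (nhdsWithin 0 (Set.Ioi 0)) (nhds (((k.factorial : ℂ)⁻¹ * z ^ k) • w₁)) := by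
    intro z
    have := tendsto_inv_pow_smul_of_iteratedFDeriv_eq_zero isOpen_ball (convex_ball _ _) h₀
      (husmooth.of_le (by exact_mod_cast le_top)) hmin z
    rw [happly, Fin.prod_const, ← algebraMap_smul ℂ, smul_smul] at this
    simpa using this
  have hcoef : ∀ z : ℂ, z ≠ 0 → ((k.factorial : ℂ)⁻¹ * z ^ k) • w₁ ≠ 0 := fun z hz =>
    smul_ne_zero (mul_ne_zero (inv_ne_zero (by exact_mod_cast k.factorial_ne_zero))
      (pow_ne_zero k hz)) hw₁0
  refine ⟨(ℂ ∙ w₁, k), ⟨finrank_span_singleton hw₁0, hkpos, fun z hz =>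
    ⟨_, hcoef z hz.2, Submodule.smul_mem _ _ (Submodule.mem_span_singleton_self w₁), hlim z⟩⟩, ?_⟩
  rintro ⟨T, l⟩ ⟨hT, -, hTl⟩
  have hhalf : (1 / 2 : ℂ) ≠ 0 := by norm_num
  obtain ⟨w, hw, hwT, hwlim⟩ := hTl (1 / 2) ⟨by norm_num, hhalf⟩
  obtain rfl : l = k :=
    le_antisymm (le_of_tendsto_inv_pow_smul (hcoef _ hhalf) hwlim (hlim _))
      (le_of_tendsto_inv_pow_smul hw (hlim _) hwlim)
  have hww := tendsto_nhds_unique hwlim (hlim _)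
  rw [hww] at hwT
  have hw₁T : w₁ ∈ T := by
    refine (T.smul_mem_iff fun h => hcoef _ hhalf ?_).1 hwT
    rw [h, zero_smul]
  have : FiniteDimensional ℂ T := Module.finite_of_finrank_eq_succ hT
  exact Prod.ext (Submodule.eq_of_le_of_finrank_eq
    ((Submodule.span_singleton_le_iff_mem _ _).2 hw₁T)
    ((finrank_span_singleton hw₁0).trans hT.symm)).symm rfl
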